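/- arXiv:1812.03857 — 9 statements merged into one kernel-verified Lean document; each statement's English description precedes it below -/
import Mathlib

section
/- For every ε ≥ 0 and every λ ∈ ℂ, det Δ(ε,λ) = 0 if and only if P(ε,λ) = 0, where Δ(ε,s) = s·E(ε) − A − B e^{−τs} − C e^{−2τs} is the characteristic matrix of the hybrid two-layer scattering system, with E(ε) = diag(1,1,ε), A = [[−a₁r₂, 0, a₁a₀], [0, −(a₁−a₂)r₄a₅, 0], [0, 0, −1]], B = [[0,0,0], [−a₅a₁r₂, 0, a₂a₀a₅], [0, −a₅r₄/a₀, 0]], and C = [[0,0,0], [0,0,0], [−a₁r₂(a₅−1)/((a₁−a₂)a₀), 0, a₂(a₅−1)/(a₁−a₂)]]. -/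
open Complex Matrix

/-- The characteristic function of the singularly perturbed two-layer system. -/
noncomputable def P (a1 a2 a5 r2 r4 τ ε : ℝ) (lam : ℂ) : ℂ :=
  (1 + ε * lam) * (lam + a5 * r4 * (a1 - a2)) * (lam + a1 * r2)
    - Complex.exp (-2 * τ * lam) * ((lam + a1 * r2) * a2 - a1 ^ 2 * r2)
        * (lam * (a5 - 1) / (a1 - a2) - a5 * r4)

/-- The characteristic matrix Δ(ε,s) = s·E(ε) − A − B e^{−τs} − C e^{−2τs}
of the hybrid two-layer scattering system. -/
noncomputable def charMatrix (a0 a1 a2 a5 r2 r4 τ ε : ℝ) (s : ℂ) : Matrix (Fin 3) (Fin 3) ℂ :=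
  s • (Matrix.diagonal ![1, 1, (ε : ℂ)])
    - !![(-(a1 * r2) : ℂ), 0, (a1 * a0 : ℝ);
         0, (-((a1 - a2) * r4 * a5) : ℝ), 0;
         0, 0, -1]
    - Complex.exp (-τ * s) • !![(0 : ℂ), 0, 0;
         (-(a5 * a1 * r2) : ℝ), 0, (a2 * a0 * a5 : ℝ);
         0, (-(a5 * r4 / a0) : ℝ), 0]
    - Complex.exp (-2 * τ * s) • !![(0 : ℂ), 0, 0;
         0, 0, 0;
         (-(a1 * r2 * (a5 - 1) / ((a1 - a2) * a0)) : ℝ), 0, (a2 * (a5 - 1) / (a1 - a2) : ℝ)]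

theorem det_charMatrix_eq_zero_iff (c1 c3 c5 r2 r4 a0 τ : ℝ)
    (hc1 : 0 < c1) (hc3 : 0 < c3) (hc5 : 0 < c5)
    (hr2 : 0 < r2) (hr4 : 0 < r4) (ha0 : 0 < a0) (hτ : 0 < τ)
    (a1 a2 a5 : ℝ)
    (ha1 : a1 = 4 * Real.pi * c1 * c3 / (c1 + c3))
    (ha2 : a2 = 2 * Real.pi * c3 * (c1 - c3) / (c1 + c3))
    (ha5 : a5 = 2 * c5 / (c5 + c3))
    (ε : ℝ) (hε : 0 ≤ ε) (lam : ℂ) :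
    (charMatrix a0 a1 a2 a5 r2 r4 τ ε lam).det = 0 ↔ P a1 a2 a5 r2 r4 τ ε lam = 0 := by
  have hd : a1 - a2 = 2 * Real.pi * c3 := by
    rw [ha1, ha2]
    have : c1 + c3 ≠ 0 := by positivity
    field_simp
    ring
  have hdR : a1 - a2 ≠ 0 := by
    rw [hd]
    have := Real.pi_pos
    positivity
  have hdC : (a1 : ℂ) - a2 ≠ 0 := by exact_mod_cast hdR
  have haC : (a0 : ℂ) ≠ 0 := by exact_mod_cast ha0.ne'
  have hexp : Complex.exp (-2 * τ * lam) = Complex.exp (-τ * lam) ^ 2 := by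
    rw [← Complex.exp_nat_mul]
    congr 1
    push_cast
    ring
  have key : (charMatrix a0 a1 a2 a5 r2 r4 τ ε lam).det = P a1 a2 a5 r2 r4 τ ε lam := by
    unfold charMatrix P
    rw [hexp]
    generalize Complex.exp (-τ * lam) = q
    rw [Matrix.det_fin_three]
    simp [Matrix.diagonal_apply]
    field_simp
    ring
  rw [key]
end

section
/- For every ε ≥ 0, λ = 0 is a simple root of the characteristic equation P(ε,λ) = 0: one has P(ε,0) = 0 and the derivative in λ satisfies (∂P/∂λ)(ε,0) = a₁ a₅ [r₂ + r₄ + (2τ + ε) r₂ r₄ (a₁−a₂)], which is strictly positive. -/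
open Complex

theorem zero_is_simple_root (c1 c3 c5 r2 r4 τ : ℝ)
    (hc1 : 0 < c1) (hc3 : 0 < c3) (hc5 : 0 < c5)
    (hr2 : 0 < r2) (hr4 : 0 < r4) (hτ : 0 < τ)
    (a1 a2 a5 : ℝ)
    (ha1 : a1 = 4 * Real.pi * c1 * c3 / (c1 + c3))
    (ha2 : a2 = 2 * Real.pi * c3 * (c1 - c3) / (c1 + c3))
    (ha5 : a5 = 2 * c5 / (c5 + c3))
    (ε : ℝ) (hε : 0 ≤ ε) :
    P a1 a2 a5 r2 r4 τ ε 0 = 0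
    ∧ deriv (fun lam => P a1 a2 a5 r2 r4 τ ε lam) 0
        = ((a1 * a5 * (r2 + r4 + (2 * τ + ε) * r2 * r4 * (a1 - a2)) : ℝ) : ℂ)
    ∧ 0 < a1 * a5 * (r2 + r4 + (2 * τ + ε) * r2 * r4 * (a1 - a2)) := by
  have hpi := Real.pi_pos
  have hd : a1 - a2 = 2 * Real.pi * c3 := by
    rw [ha1, ha2]
    field_simp
    ring
  have hdpos : 0 < a1 - a2 := by rw [hd]; positivity
  have ha1pos : 0 < a1 := by rw [ha1]; positivity
  have ha5pos : 0 < a5 := by rw [ha5]; positivity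
  have hdC : (a1 : ℂ) - a2 ≠ 0 := by
    have : ((a1 - a2 : ℝ) : ℂ) ≠ 0 := by exact_mod_cast hdpos.ne'
    simpa using this
  refine ⟨?_, ?_, ?_⟩
  · simp only [P, mul_zero, Complex.exp_zero, zero_mul, zero_div]
    ring
  · have hid := hasDerivAt_id (0 : ℂ)
    have h1 := (hid.const_mul (ε : ℂ)).const_add 1
    have h2 := hid.add_const ((a5 : ℂ) * r4 * (a1 - a2))
    have h3 := hid.add_const ((a1 : ℂ) * r2)
    have h4 := (hid.const_mul (-2 * (τ : ℂ))).cexp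
    have h5 := (h3.mul_const (a2 : ℂ)).sub_const ((a1 : ℂ) ^ 2 * r2)
    have h6 := ((hid.mul_const ((a5 : ℂ) - 1)).div_const ((a1 : ℂ) - a2)).sub_const
      ((a5 : ℂ) * r4)
    have h := ((h1.mul h2).mul h3).sub ((h4.mul h5).mul h6)
    have h' : deriv (fun lam => P a1 a2 a5 r2 r4 τ ε lam) 0 = _ := h.deriv
    rw [h']
    simp
    field_simp
    ring
  · positivity
end

section
/- For every ε ≥ 0, every root λ ∈ ℂ of the characteristic equation P(ε,λ) = 0 with λ ≠ 0 satisfies Re(λ) < 0. -/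
open Complex

lemma norm_factor_lt (g A : ℝ) (hg1 : -1 < g) (hg2 : g < 1) (hA : 0 < A) (z : ℂ)
    (hz : 0 ≤ z.re) (hne : z ≠ 0) : ‖(g : ℂ) * z - A‖ < ‖z + A‖ := by
  have h0 : 0 < z.re * z.re + z.im * z.im := by
    have := Complex.normSq_pos.mpr hne
    rwa [Complex.normSq_apply] at this
  rw [← sq_lt_sq₀ (norm_nonneg _) (norm_nonneg _), ← Complex.normSq_eq_norm_sq,
    ← Complex.normSq_eq_norm_sq, Complex.normSq_apply, Complex.normSq_apply]
  simp
  have h1 : 0 < (1 - g) * (1 + g) * (z.re * z.re + z.im * z.im) :=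
    mul_pos (mul_pos (by linarith) (by linarith)) h0
  have h2 : 0 ≤ A * (1 + g) * z.re :=
    mul_nonneg (mul_nonneg hA.le (by linarith)) hz
  nlinarith

theorem nonzero_roots_have_negative_real_part (c1 c3 c5 r2 r4 τ : ℝ)
    (hc1 : 0 < c1) (hc3 : 0 < c3) (hc5 : 0 < c5)
    (hr2 : 0 < r2) (hr4 : 0 < r4) (hτ : 0 < τ)
    (a1 a2 a5 : ℝ)
    (ha1 : a1 = 4 * Real.pi * c1 * c3 / (c1 + c3))
    (ha2 : a2 = 2 * Real.pi * c3 * (c1 - c3) / (c1 + c3))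
    (ha5 : a5 = 2 * c5 / (c5 + c3))
    (ε : ℝ) (hε : 0 ≤ ε) (lam : ℂ)
    (hroot : P a1 a2 a5 r2 r4 τ ε lam = 0) (hne : lam ≠ 0) :
    lam.re < 0 := by
  by_contra hcon
  have hz : 0 ≤ lam.re := not_lt.mp hcon
  have hpi := Real.pi_pos
  have h13 : 0 < c1 + c3 := by linarith
  have h53 : 0 < c5 + c3 := by linarith
  obtain ⟨g, hg⟩ : ∃ g : ℝ, g = (c1 - c3) / (c1 + c3) := ⟨_, rfl⟩
  obtain ⟨D, hD⟩ : ∃ D : ℝ, D = 2 * Real.pi * c3 := ⟨_, rfl⟩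
  have hDpos : 0 < D := by rw [hD]; positivity
  have hg1 : -1 < g := by rw [hg, lt_div_iff₀ h13]; linarith
  have hg2 : g < 1 := by rw [hg, div_lt_iff₀ h13]; linarith
  have e2 : a2 = D * g := by rw [ha2, hD, hg]; ring
  have e1 : a1 = D * (1 + g) := by rw [ha1, hD, hg]; field_simp; ring
  have h5 : 0 < a5 := by rw [ha5]; positivity
  have h52 : a5 < 2 := by rw [ha5, div_lt_iff₀ h53]; linarith
  have h1 : 0 < a1 := by rw [ha1]; positivity
  have hf1 := norm_factor_lt g (a1 * r2) hg1 hg2 (by positivity) lam hz hne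
  have hf2 := norm_factor_lt (a5 - 1) (a5 * r4 * D) (by linarith) (by linarith)
    (by positivity) lam hz hne
  have hDne : (D : ℂ) ≠ 0 := by exact_mod_cast hDpos.ne'
  have hsub : (a1 : ℂ) - a2 = D := by rw [e1, e2]; push_cast; ring
  have key : (1 + ε * lam) * ((lam + (a5 * r4 * D : ℝ)) * (lam + (a1 * r2 : ℝ)))
      = Complex.exp (-2 * τ * lam) * ((((a5 - 1 : ℝ) : ℂ) * lam - (a5 * r4 * D : ℝ))
        * ((g : ℂ) * lam - (a1 * r2 : ℝ))) := by
    have h := sub_eq_zero.mp hroot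
    rw [hsub] at h
    have hfac : ((lam + a1 * r2) * a2 - a1 ^ 2 * r2 : ℂ)
        = D * ((g : ℂ) * lam - (a1 * r2 : ℝ)) := by
      rw [e1, e2]; push_cast; ring
    have hfac2 : (lam * (a5 - 1) / D - a5 * r4 : ℂ)
        = (((a5 - 1 : ℝ) : ℂ) * lam - (a5 * r4 * D : ℝ)) / D := by
      push_cast; field_simp
    rw [hfac, hfac2] at h
    push_cast at h ⊢
    rw [← mul_assoc, h]
    field_simp
  have hn := congrArg norm key
  simp only [norm_mul _ _] at hn
  have hexp : ‖Complex.exp (-2 * τ * lam)‖ ≤ 1 := by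
    rw [Complex.norm_exp, Real.exp_le_one_iff]
    simp
    positivity
  have hone : 1 ≤ ‖1 + (ε : ℂ) * lam‖ := by
    refine le_trans ?_ (Complex.re_le_norm _)
    simp
    positivity
  have hlt := mul_lt_mul'' hf2 hf1 (norm_nonneg _) (norm_nonneg _)
  simp only [← norm_mul] at hn hlt
  rw [norm_mul, norm_mul (Complex.exp _)] at hn
  have t1 := mul_le_mul_of_nonneg_right hexp (norm_nonneg
    ((((a5 - 1 : ℝ) : ℂ) * lam - (a5 * r4 * D : ℝ)) * ((g : ℂ) * lam - (a1 * r2 : ℝ))))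
  have t2 := mul_le_mul_of_nonneg_right hone (norm_nonneg
    ((lam + (a5 * r4 * D : ℝ)) * (lam + (a1 * r2 : ℝ))))
  linarith
end

section
/- Define, for y ∈ ℝ, l₀(y) = (a₁²r₂² + y²)(4π²c₃²a₅²r₄² + y²) and r₀(y) = (a₁²r₂² + (a₂²/(4π²c₃²)) y²)(4π²c₃²a₅²r₄² + (a₅−1)² y²). Then l₀(y) − r₀(y) = y² [ ((a₁(a₁−2a₂) + a₂²a₅(2−a₅))/(4π²c₃²)) y² + a₅²r₄²a₁(a₁−2a₂) + a₁²r₂²a₅(2−a₅) ], and since a₁ > 0, 0 < a₅ < 2 and a₁ − 2a₂ > 0, this quantity is strictly positive for every y ≠ 0. -/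
theorem l0_sub_r0_identity_and_pos (c1 c3 c5 r2 r4 : ℝ)
    (hc1 : 0 < c1) (hc3 : 0 < c3) (hc5 : 0 < c5)
    (hr2 : 0 < r2) (hr4 : 0 < r4)
    (a1 a2 a5 : ℝ)
    (ha1 : a1 = 4 * Real.pi * c1 * c3 / (c1 + c3))
    (ha2 : a2 = 2 * Real.pi * c3 * (c1 - c3) / (c1 + c3))
    (ha5 : a5 = 2 * c5 / (c5 + c3))
    (y : ℝ) :
    (a1 ^ 2 * r2 ^ 2 + y ^ 2) * (4 * Real.pi ^ 2 * c3 ^ 2 * a5 ^ 2 * r4 ^ 2 + y ^ 2)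
      - (a1 ^ 2 * r2 ^ 2 + (a2 ^ 2 / (4 * Real.pi ^ 2 * c3 ^ 2)) * y ^ 2)
          * (4 * Real.pi ^ 2 * c3 ^ 2 * a5 ^ 2 * r4 ^ 2 + (a5 - 1) ^ 2 * y ^ 2)
      = y ^ 2 * (((a1 * (a1 - 2 * a2) + a2 ^ 2 * a5 * (2 - a5)) / (4 * Real.pi ^ 2 * c3 ^ 2)) * y ^ 2
          + a5 ^ 2 * r4 ^ 2 * a1 * (a1 - 2 * a2) + a1 ^ 2 * r2 ^ 2 * a5 * (2 - a5))
    ∧ (y ≠ 0 →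
        0 < (a1 ^ 2 * r2 ^ 2 + y ^ 2) * (4 * Real.pi ^ 2 * c3 ^ 2 * a5 ^ 2 * r4 ^ 2 + y ^ 2)
          - (a1 ^ 2 * r2 ^ 2 + (a2 ^ 2 / (4 * Real.pi ^ 2 * c3 ^ 2)) * y ^ 2)
              * (4 * Real.pi ^ 2 * c3 ^ 2 * a5 ^ 2 * r4 ^ 2 + (a5 - 1) ^ 2 * y ^ 2)) := by
  have hpi := Real.pi_pos
  have h1 : 0 < a1 := by rw [ha1]; positivity
  have h12 : a1 - 2 * a2 = 4 * Real.pi * c3 ^ 2 / (c1 + c3) := by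
    rw [ha1, ha2]; field_simp; ring
  have h12p : 0 < a1 - 2 * a2 := by rw [h12]; positivity
  have h5 : 0 < a5 := by rw [ha5]; positivity
  have h5' : 0 < 2 - a5 := by
    have : 2 - a5 = 2 * c3 / (c5 + c3) := by rw [ha5]; field_simp; ring
    rw [this]; positivity
  have hd : a1 - a2 = 2 * Real.pi * c3 := by
    rw [ha1, ha2]; field_simp; ring
  have hK : 4 * Real.pi ^ 2 * c3 ^ 2 = (a1 - a2) ^ 2 := by rw [hd]; ring
  have hne : a1 - a2 ≠ 0 := by rw [hd]; positivity
  rw [hK]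
  clear hK hd h12 ha1 ha2 ha5
  have key : (a1 ^ 2 * r2 ^ 2 + y ^ 2) * ((a1 - a2) ^ 2 * a5 ^ 2 * r4 ^ 2 + y ^ 2)
      - (a1 ^ 2 * r2 ^ 2 + (a2 ^ 2 / (a1 - a2) ^ 2) * y ^ 2)
          * ((a1 - a2) ^ 2 * a5 ^ 2 * r4 ^ 2 + (a5 - 1) ^ 2 * y ^ 2)
      = y ^ 2 * (((a1 * (a1 - 2 * a2) + a2 ^ 2 * a5 * (2 - a5)) / (a1 - a2) ^ 2) * y ^ 2
          + a5 ^ 2 * r4 ^ 2 * a1 * (a1 - 2 * a2) + a1 ^ 2 * r2 ^ 2 * a5 * (2 - a5)) := by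
    field_simp
    ring
  refine ⟨key, fun hy => ?_⟩
  rw [key]
  generalize a1 - 2 * a2 = u at *
  generalize 2 - a5 = v at *
  positivity
end

section
/- For every ε ≥ 0 and every real y ≠ 0, the characteristic function does not vanish at the purely imaginary point iy: P(ε, iy) ≠ 0. In other words, the characteristic equation of the singularly perturbed two-layer system has no nonzero purely imaginary roots. -/
open Complex

theorem no_nonzero_purely_imaginary_roots (c1 c3 c5 r2 r4 τ : ℝ)
    (hc1 : 0 < c1) (hc3 : 0 < c3) (hc5 : 0 < c5)
    (hr2 : 0 < r2) (hr4 : 0 < r4) (hτ : 0 < τ)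
    (a1 a2 a5 : ℝ)
    (ha1 : a1 = 4 * Real.pi * c1 * c3 / (c1 + c3))
    (ha2 : a2 = 2 * Real.pi * c3 * (c1 - c3) / (c1 + c3))
    (ha5 : a5 = 2 * c5 / (c5 + c3))
    (ε : ℝ) (hε : 0 ≤ ε) (y : ℝ) (hy : y ≠ 0) :
    P a1 a2 a5 r2 r4 τ ε (Complex.I * y) ≠ 0 := by
  have hpi := Real.pi_pos
  obtain ⟨d, hd⟩ : ∃ d, d = a1 - a2 := ⟨_, rfl⟩
  have hd' : d = 2 * Real.pi * c3 := by
    rw [hd, ha1, ha2]; field_simp; ring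
  have hdpos : 0 < d := by rw [hd']; positivity
  have ha1pos : 0 < a1 := by rw [ha1]; positivity
  have ha5pos : 0 < a5 := by rw [ha5]; positivity
  have h2 : a2 ^ 2 < d ^ 2 := by
    have : a2 = d * ((c1 - c3) / (c1 + c3)) := by rw [ha2, hd']; ring
    have hk : ((c1 - c3) / (c1 + c3)) ^ 2 < 1 := by
      rw [div_pow, div_lt_one (by positivity)]; nlinarith [mul_pos hc1 hc3]
    rw [this, mul_pow]
    nlinarith [pow_pos hdpos 2]
  have h5 : (a5 - 1) ^ 2 < 1 := by
    have : a5 - 1 = (c5 - c3) / (c5 + c3) := by rw [ha5]; field_simp; ring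
    rw [this, div_pow, div_lt_one (by positivity)]; nlinarith [mul_pos hc5 hc3]
  have hy2 : 0 < y ^ 2 := by positivity
  intro h
  unfold P at h
  have h := congrArg Complex.normSq (sub_eq_zero.mp h)
  have e0 : Complex.normSq (Complex.exp (-2 * τ * (Complex.I * y))) = 1 := by
    rw [Complex.normSq_eq_norm_sq, Complex.norm_exp]; simp
  have e1 : Complex.normSq (1 + ε * (Complex.I * y)) = 1 + ε ^ 2 * y ^ 2 := by
    simp [Complex.normSq_apply]; ring
  have e2 : Complex.normSq (Complex.I * y + a5 * r4 * (a1 - a2)) = y ^ 2 + (a5 * r4 * d) ^ 2 := by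
    rw [hd]; simp [Complex.normSq_apply]; ring
  have e3 : Complex.normSq (Complex.I * y + a1 * r2) = y ^ 2 + (a1 * r2) ^ 2 := by
    simp [Complex.normSq_apply]; ring
  have e4 : Complex.normSq ((Complex.I * y + a1 * r2) * a2 - a1 ^ 2 * r2)
      = y ^ 2 * a2 ^ 2 + (a1 * r2) ^ 2 * d ^ 2 := by
    have : (Complex.I * y + a1 * r2) * a2 - a1 ^ 2 * r2
      = ((-(a1 * r2 * d) : ℝ) : ℂ) + ((y * a2 : ℝ) : ℂ) * Complex.I := by
      rw [hd]; push_cast; ring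
    rw [this, Complex.normSq_add_mul_I]; ring
  have e5 : Complex.normSq (Complex.I * y * (a5 - 1) / (a1 - a2) - a5 * r4)
      = y ^ 2 * (a5 - 1) ^ 2 / d ^ 2 + (a5 * r4) ^ 2 := by
    have : Complex.I * y * (a5 - 1) / (a1 - a2) - a5 * r4
      = ((-(a5 * r4) : ℝ) : ℂ) + ((y * (a5 - 1) / d : ℝ) : ℂ) * Complex.I := by
      rw [hd]; push_cast; ring
    rw [this, Complex.normSq_add_mul_I]; ring
  simp only [Complex.normSq_mul] at h
  rw [e0, e1, e2, e3, e4, e5, one_mul] at h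
  have f4 : y ^ 2 * a2 ^ 2 + (a1 * r2) ^ 2 * d ^ 2 < (y ^ 2 + (a1 * r2) ^ 2) * d ^ 2 := by
    nlinarith
  have f5 : (y ^ 2 * (a5 - 1) ^ 2 / d ^ 2 + (a5 * r4) ^ 2) * d ^ 2
      < y ^ 2 + (a5 * r4 * d) ^ 2 := by
    have : (y ^ 2 * (a5 - 1) ^ 2 / d ^ 2 + (a5 * r4) ^ 2) * d ^ 2
      = y ^ 2 * (a5 - 1) ^ 2 + (a5 * r4 * d) ^ 2 := by field_simp
    rw [this]; nlinarith
  have p5 : 0 < y ^ 2 * (a5 - 1) ^ 2 / d ^ 2 + (a5 * r4) ^ 2 := by positivity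
  have p3 : 0 < y ^ 2 + (a1 * r2) ^ 2 := by positivity
  have p2 : 0 < y ^ 2 + (a5 * r4 * d) ^ 2 := by positivity
  have g1 := mul_lt_mul_of_pos_right f4 p5
  have g2 := mul_lt_mul_of_pos_left f5 p3
  have g3 : 0 ≤ ε ^ 2 * y ^ 2 * ((y ^ 2 + (a5 * r4 * d) ^ 2) * (y ^ 2 + (a1 * r2) ^ 2)) := by
    positivity
  linarith
end

section
/- λ = 0 is a simple root of the characteristic equation Q(λ) = 0: one has Q(0) = 0 and Q′(0) = a₁ [r₂ + r₄ + 2τ r₂ r₄ (a₁−a₂)], which is strictly positive. -/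
open Complex

/-- The characteristic function of the reduced system (case n₃ = n₅). -/
noncomputable def Q (a1 a2 r2 r4 τ : ℝ) (lam : ℂ) : ℂ :=
  (lam + a1 * r2) * (lam + (a1 - a2) * r4)
    - r4 * Complex.exp (-2 * τ * lam) * (a1 * r2 * (a1 - a2) - a2 * lam)

theorem zero_is_simple_root_reduced (c1 c3 r2 r4 τ : ℝ)
    (hc1 : 0 < c1) (hc3 : 0 < c3)
    (hr2 : 0 < r2) (hr4 : 0 < r4) (hτ : 0 < τ)
    (a1 a2 : ℝ)
    (ha1 : a1 = 4 * Real.pi * c1 * c3 / (c1 + c3))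
    (ha2 : a2 = 2 * Real.pi * c3 * (c1 - c3) / (c1 + c3)) :
    Q a1 a2 r2 r4 τ 0 = 0
    ∧ deriv (fun lam => Q a1 a2 r2 r4 τ lam) 0
        = ((a1 * (r2 + r4 + 2 * τ * r2 * r4 * (a1 - a2)) : ℝ) : ℂ)
    ∧ 0 < a1 * (r2 + r4 + 2 * τ * r2 * r4 * (a1 - a2)) := by
  have hs : 0 < c1 + c3 := by positivity
  have hpi := Real.pi_pos
  have h1 : 0 < a1 := by rw [ha1]; positivity
  have h2 : a1 - a2 = 2 * Real.pi * c3 := by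
    rw [ha1, ha2]
    field_simp
    ring
  refine ⟨?_, ?_, ?_⟩
  · simp [Q]
    ring
  · have hid := hasDerivAt_id (0 : ℂ)
    have hA := (hid.add_const ((a1 : ℂ) * r2)).mul (hid.add_const (((a1 : ℂ) - a2) * r4))
    have hE := ((hid.const_mul (-2 * (τ : ℂ))).cexp).const_mul (r4 : ℂ)
    have hL := (hid.const_mul (a2 : ℂ)).const_sub ((a1 : ℂ) * r2 * (a1 - a2))
    have hQ := hA.sub (hE.mul hL)
    have hd : deriv (fun lam => Q a1 a2 r2 r4 τ lam) 0 = _ := hQ.deriv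
    rw [hd]
    simp
    ring
  · rw [h2]
    positivity
end

section
/- Every root λ ∈ ℂ of the characteristic equation Q(λ) = 0 with λ ≠ 0 satisfies Re(λ) < 0. -/
open Complex

theorem nonzero_roots_negative_real_part_reduced (c1 c3 r2 r4 τ : ℝ)
    (hc1 : 0 < c1) (hc3 : 0 < c3)
    (hr2 : 0 < r2) (hr4 : 0 < r4) (hτ : 0 < τ)
    (a1 a2 : ℝ)
    (ha1 : a1 = 4 * Real.pi * c1 * c3 / (c1 + c3))
    (ha2 : a2 = 2 * Real.pi * c3 * (c1 - c3) / (c1 + c3))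
    (lam : ℂ) (hroot : Q a1 a2 r2 r4 τ lam = 0) (hne : lam ≠ 0) :
    lam.re < 0 := by
  have hs : 0 < c1 + c3 := by positivity
  have hpi := Real.pi_pos
  have ha1pos : 0 < a1 := by rw [ha1]; positivity
  have hd1 : 0 < a1 - a2 - a2 := by
    have : a1 - a2 - a2 = 4 * Real.pi * c3 * c3 / (c1 + c3) := by
      rw [ha1, ha2]; field_simp; ring
    rw [this]; positivity
  have hd2 : 0 < a1 - a2 + a2 := by linarith
  have hd : 0 < a1 - a2 := by linarith
  by_contra hcon
  have hx : 0 ≤ lam.re := not_lt.mp hcon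
  have hA : 0 < a1 * r2 := by positivity
  have heq : (lam + a1 * r2) * (lam + (a1 - a2) * r4)
      = r4 * Complex.exp (-2 * τ * lam) * (a1 * r2 * (a1 - a2) - a2 * lam) :=
    sub_eq_zero.mp hroot
  have hn := congrArg Complex.normSq heq
  have hE : Complex.normSq (Complex.exp (-2 * τ * lam)) ≤ 1 := by
    rw [Complex.normSq_eq_norm_sq, Complex.norm_exp]
    have h1 : (-2 * (τ : ℂ) * lam).re ≤ 0 := by
      have h2 : (-2 * (τ : ℂ) * lam).re = -2 * (τ * lam.re) := by
        simp; ring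
      rw [h2]
      have := mul_nonneg hτ.le hx
      linarith
    exact pow_le_one₀ (Real.exp_pos _).le (Real.exp_le_one_iff.mpr h1)
  rw [Complex.normSq_mul, Complex.normSq_mul, Complex.normSq_mul] at hn
  have hxy : 0 < lam.re ^ 2 + lam.im ^ 2 := by
    have := Complex.normSq_pos.mpr hne
    rw [Complex.normSq_apply] at this
    nlinarith
  have e1 : Complex.normSq (lam + a1 * r2) = (lam.re + a1 * r2) ^ 2 + lam.im ^ 2 := by
    rw [Complex.normSq_apply]; simp; ring
  have e2 : Complex.normSq (lam + (a1 - a2) * r4)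
      = (lam.re + (a1 - a2) * r4) ^ 2 + lam.im ^ 2 := by
    rw [Complex.normSq_apply]; simp; ring
  have e3 : Complex.normSq (a1 * r2 * (a1 - a2) - a2 * lam)
      = (a1 * r2 * (a1 - a2) - a2 * lam.re) ^ 2 + a2 ^ 2 * lam.im ^ 2 := by
    rw [Complex.normSq_apply]; simp; ring
  rw [e1, e2, e3, Complex.normSq_ofReal] at hn
  generalize Complex.normSq (Complex.exp (-2 * τ * lam)) = E at hn hE
  generalize lam.re = x at *
  generalize lam.im = y at *
  generalize a1 * r2 = A at *
  generalize a1 - a2 = d at *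
  have hB : (d * r4) ^ 2 ≤ (x + d * r4) ^ 2 + y ^ 2 := by
    have : 0 ≤ x * (d * r4) := by positivity
    nlinarith [sq_nonneg x, sq_nonneg y]
  have h1 : ((x + A) ^ 2 + y ^ 2) * (d * r4) ^ 2
      ≤ ((x + A) ^ 2 + y ^ 2) * ((x + d * r4) ^ 2 + y ^ 2) :=
    mul_le_mul_of_nonneg_left hB (by positivity)
  have h2 : E * (r4 * r4 * ((A * d - a2 * x) ^ 2 + a2 ^ 2 * y ^ 2))
      ≤ 1 * (r4 * r4 * ((A * d - a2 * x) ^ 2 + a2 ^ 2 * y ^ 2)) :=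
    mul_le_mul_of_nonneg_right hE (by positivity)
  have h3 : 0 < r4 ^ 2 * ((d - a2) * (d + a2) * (x ^ 2 + y ^ 2)) := by positivity
  have h4 : 0 ≤ r4 ^ 2 * (2 * A * d * x * (d + a2)) := by positivity
  linarith
end

section
/- For every real y ≠ 0 one has Q(iy) ≠ 0; that is, the characteristic equation of the reduced system has no nonzero purely imaginary roots. -/
open Complex

theorem no_nonzero_purely_imaginary_roots_reduced (c1 c3 r2 r4 τ : ℝ)
    (hc1 : 0 < c1) (hc3 : 0 < c3)
    (hr2 : 0 < r2) (hr4 : 0 < r4) (hτ : 0 < τ)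
    (a1 a2 : ℝ)
    (ha1 : a1 = 4 * Real.pi * c1 * c3 / (c1 + c3))
    (ha2 : a2 = 2 * Real.pi * c3 * (c1 - c3) / (c1 + c3))
    (y : ℝ) (hy : y ≠ 0) :
    Q a1 a2 r2 r4 τ (Complex.I * y) ≠ 0 := by
  have hs : 0 < c1 + c3 := by positivity
  have hpi := Real.pi_pos
  have h1 : 0 < a1 := by rw [ha1]; positivity
  have h2 : 0 < a1 - 2 * a2 := by
    have h : a1 - 2 * a2 = 4 * Real.pi * c3 ^ 2 / (c1 + c3) := by
      rw [ha1, ha2]; field_simp; ring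
    rw [h]; positivity
  clear ha1 ha2
  intro h
  unfold Q at h
  have h3 := congrArg Complex.normSq (sub_eq_zero.mp h)
  have he : Complex.normSq (Complex.exp (-2 * τ * (Complex.I * y))) = 1 := by
    rw [Complex.normSq_eq_norm_sq, Complex.norm_exp]
    simp
  simp only [map_mul, he] at h3
  have hy2 : 0 < y ^ 2 := by positivity
  simp [Complex.normSq_apply] at h3
  have h4 : y ^ 2 * (y ^ 2 + (a1 * r2) ^ 2 + r4 ^ 2 * (a1 * (a1 - 2 * a2))) = 0 := by
    linear_combination h3
  have h5 : 0 < y ^ 2 * (y ^ 2 + (a1 * r2) ^ 2 + r4 ^ 2 * (a1 * (a1 - 2 * a2))) := by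
    positivity
  exact h5.ne' h4
end

section
/- Let S = A + B + C be the sum of the three coefficient matrices of the hybrid system, i.e. A = [[−a₁r₂, 0, a₁a₀], [0, −(a₁−a₂)r₄a₅, 0], [0, 0, −1]], B = [[0,0,0], [−a₅a₁r₂, 0, a₂a₀a₅], [0, −a₅r₄/a₀, 0]], C = [[0,0,0], [0,0,0], [−a₁r₂(a₅−1)/((a₁−a₂)a₀), 0, a₂(a₅−1)/(a₁−a₂)]]. Then the vector v = (1, −r₂/r₄, r₂/a₀) satisfies S v = 0, and the kernel of S is one-dimensional, spanned by v. -/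
open Matrix

theorem kernel_of_sum_hybrid (c1 c3 c5 r2 r4 a0 : ℝ)
    (hc1 : 0 < c1) (hc3 : 0 < c3) (hc5 : 0 < c5)
    (hr2 : 0 < r2) (hr4 : 0 < r4) (ha0 : 0 < a0)
    (a1 a2 a5 : ℝ)
    (ha1 : a1 = 4 * Real.pi * c1 * c3 / (c1 + c3))
    (ha2 : a2 = 2 * Real.pi * c3 * (c1 - c3) / (c1 + c3))
    (ha5 : a5 = 2 * c5 / (c5 + c3)) :
    let A : Matrix (Fin 3) (Fin 3) ℝ :=
      !![-(a1 * r2), 0, a1 * a0;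
         0, -((a1 - a2) * r4 * a5), 0;
         0, 0, -1]
    let B : Matrix (Fin 3) (Fin 3) ℝ :=
      !![0, 0, 0;
         -(a5 * a1 * r2), 0, a2 * a0 * a5;
         0, -(a5 * r4 / a0), 0]
    let C : Matrix (Fin 3) (Fin 3) ℝ :=
      !![0, 0, 0;
         0, 0, 0;
         -(a1 * r2 * (a5 - 1) / ((a1 - a2) * a0)), 0, a2 * (a5 - 1) / (a1 - a2)]
    let S : Matrix (Fin 3) (Fin 3) ℝ := A + B + C
    let v : Fin 3 → ℝ := ![1, -r2 / r4, r2 / a0]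
    S.mulVec v = 0 ∧ ∀ w : Fin 3 → ℝ, S.mulVec w = 0 → ∃ c : ℝ, w = c • v := by
  have hpi := Real.pi_pos
  have h1 : 0 < a1 := by rw [ha1]; positivity
  have h5 : 0 < a5 := by rw [ha5]; positivity
  have hd : 0 < a1 - a2 := by
    have : a1 - a2 = 2 * Real.pi * c3 := by
      rw [ha1, ha2]; field_simp; ring
    rw [this]; positivity
  clear ha1 ha2 ha5
  obtain ⟨d, rfl⟩ : ∃ d, a2 = a1 - d := ⟨a1 - a2, by ring⟩
  rw [sub_sub_cancel] at hd
  intro A B C S v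
  constructor
  · funext i
    fin_cases i
    · simp [S, A, B, C, v, Matrix.mulVec, dotProduct, Fin.sum_univ_three]
      field_simp
      ring
    · simp [S, A, B, C, v, Matrix.mulVec, dotProduct, Fin.sum_univ_three]
      field_simp
      ring
    · simp [S, A, B, C, v, Matrix.mulVec, dotProduct, Fin.sum_univ_three]
      field_simp
      ring
  · intro w hw
    have e0 := congrFun hw 0
    have e1 := congrFun hw 1
    simp [S, A, B, C, Matrix.mulVec, dotProduct, Fin.sum_univ_three] at e0 e1
    have k2 : a0 * w 2 = r2 * w 0 := by
      apply mul_left_cancel₀ h1.ne'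
      linear_combination e0
    have k1 : r4 * w 1 = -(r2 * w 0) := by
      apply mul_left_cancel₀ (mul_pos hd h5).ne'
      linear_combination -e1 + (a1 - d) * a5 * k2
    refine ⟨w 0, ?_⟩
    funext i
    fin_cases i
    · simp [v]
    · simp [v]
      field_simp
      linear_combination k1
    · simp [v]
      field_simp
      linear_combination k2
end
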